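/- arXiv:2211.06754 — 3 statements merged into one kernel-verified Lean document; each statement's English description precedes it below -/
import Mathlib

section
/- Let R be a commutative ring, J ⊆ R a nilpotent ideal, and M a projective R-module. Any trivialization of M/JM lifts to a trivialization of M: given an R/J-module isomorphism φ̄ : (R/J)ⁿ → M/JM, there exists an R-module isomorphism φ : Rⁿ → M whose reduction modulo J equals φ̄. In particular, if M/JM is a free R/J-module of rank n, then M is a free R-module of rank n. -/
theorem LinearMap.range_pow_le_pow_smul_top {R M : Type*} [CommRing R] [AddCommGroup M] [Module R M]
    {J : Ideal R} {e : Module.End R M} (he : LinearMap.range e ≤ J • ⊤) (k : ℕ) :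
    LinearMap.range (e ^ k) ≤ J ^ k • ⊤ := by
  induction k with
  | zero => simp
  | succ k ih =>
    rw [pow_succ' e, Module.End.mul_eq_comp, LinearMap.range_comp]
    refine (Submodule.map_mono ih).trans ?_
    rw [Submodule.map_smul'', Submodule.map_top, pow_succ, ← smul_eq_mul, Submodule.smul_assoc]
    exact smul_mono_right _ he

theorem LinearMap.isNilpotent_of_range_le_smul_top {R M : Type*} [CommRing R] [AddCommGroup M]
    [Module R M] {J : Ideal R} (hJ : IsNilpotent J) {e : Module.End R M}
    (he : LinearMap.range e ≤ J • ⊤) : IsNilpotent e := by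
  obtain ⟨k, hk⟩ := hJ
  refine ⟨k, LinearMap.range_eq_bot.mp (le_bot_iff.mp ?_)⟩
  simpa [hk] using LinearMap.range_pow_le_pow_smul_top he k

/-- An endomorphism congruent to the identity modulo a nilpotent ideal is bijective. -/
theorem LinearMap.bijective_of_sub_mem_smul_top {R M : Type*} [CommRing R] [AddCommGroup M]
    [Module R M] {J : Ideal R} (hJ : IsNilpotent J) (e : Module.End R M)
    (he : ∀ x, e x - x ∈ (J • ⊤ : Submodule R M)) : Function.Bijective e := by
  have h : IsNilpotent (e - 1) := by
    refine LinearMap.isNilpotent_of_range_le_smul_top hJ ?_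
    rintro _ ⟨x, rfl⟩
    exact he x
  rw [← Module.End.isUnit_iff]
  simpa using h.isUnit_add_one

theorem Ideal.mem_smul_top_pi_of_forall_mem {R ι : Type*} [CommRing R] [Finite ι] {J : Ideal R}
    {x : ι → R} (hx : ∀ i, x i ∈ J) : x ∈ (J • ⊤ : Submodule R (ι → R)) := by
  classical
  cases nonempty_fintype ι
  rw [pi_eq_sum_univ' x]
  exact Submodule.sum_mem _ fun i _ => Submodule.smul_mem_smul (hx i) trivial


/-- **Nilpotent Nakayama, trivialization-lifting form.**
Let `R` be a commutative ring, `J ⊆ R` a nilpotent ideal, and `M` a projective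
`R`-module.  Any trivialization of `M/JM` lifts to a trivialization of `M`:
given an `R/J`-module isomorphism `φ̄ : (R/J)ⁿ ≃ M/JM`, there exists an
`R`-module isomorphism `φ : Rⁿ ≃ M` whose reduction modulo `J` equals `φ̄`. -/
theorem nilpotent_nakayama_trivialization_lift
    {R : Type*} [CommRing R] (J : Ideal R) (hJ : IsNilpotent J)
    {M : Type*} [AddCommGroup M] [Module R M] [Module.Projective R M]
    {n : ℕ}
    (φbar : (Fin n → R ⧸ J) ≃ₗ[R ⧸ J] (M ⧸ (J • ⊤ : Submodule R M))) :
    ∃ φ : (Fin n → R) ≃ₗ[R] M,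
      ∀ x : Fin n → R,
        Submodule.Quotient.mk (p := (J • ⊤ : Submodule R M)) (φ x)
          = φbar (fun i => Ideal.Quotient.mk J (x i)) := by
  let q : (Fin n → R) →ₗ[R] (Fin n → R ⧸ J) := J.mkQ.compLeft (Fin n)
  have hq : Function.Surjective q := J.mkQ_surjective.comp_left
  let p : M →ₗ[R] M ⧸ (J • ⊤ : Submodule R M) := (J • ⊤ : Submodule R M).mkQ
  let ψ := φbar.restrictScalars R
  obtain ⟨f, hf⟩ := Module.projective_lifting_property p (ψ.toLinearMap ∘ₗ q)
    (Submodule.mkQ_surjective _)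
  obtain ⟨g, hg⟩ := Module.projective_lifting_property q (ψ.symm.toLinearMap ∘ₗ p) hq
  have hf' (x) : p (f x) = ψ (q x) := LinearMap.congr_fun hf x
  have hg' (y) : q (g y) = ψ.symm (p y) := LinearMap.congr_fun hg y
  have hfg : Function.Bijective (f ∘ₗ g) := by
    refine LinearMap.bijective_of_sub_mem_smul_top hJ _ fun y => ?_
    rw [← Submodule.Quotient.eq]
    change p (f (g y)) = p y
    rw [hf', hg', ψ.apply_symm_apply]
  have hgf : Function.Bijective (g ∘ₗ f) := by
    refine LinearMap.bijective_of_sub_mem_smul_top hJ _ fun x =>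
      Ideal.mem_smul_top_pi_of_forall_mem fun i => ?_
    have h : q (g (f x)) = q x := by rw [hg', hf', ψ.symm_apply_apply]
    exact Ideal.Quotient.eq.mp (congrFun h i)
  rw [LinearMap.coe_comp] at hfg hgf
  exact ⟨LinearEquiv.ofBijective f ⟨hgf.injective.of_comp, hfg.surjective.of_comp⟩, hf'⟩
end

section
/- Let A be a commutative ring and let C : 0 → C⁰ → C¹ → ⋯ → C^N → 0 be a cochain complex of A-modules concentrated in degrees 0 through N, all of whose terms C^l are flat A-modules, and whose cohomology satisfies H^l(C) = 0 for all l ≥ 2. Then for every A-module M, the canonical A-linear map H¹(C) ⊗_A M → H¹(C ⊗_A M), sending the class of a 1-cocycle c tensored with m to the class of the 1-cocycle c ⊗ m of the complex C ⊗_A M, is an isomorphism. -/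
open TensorProduct

section KernelsAndFlatness

variable {A : Type*} [CommRing A] {X Y Z : Type*} [AddCommGroup X] [Module A X]
  [AddCommGroup Y] [Module A Y] [AddCommGroup Z] [Module A Z]

/-- If the range of `g` is flat, the inclusion of `ker g` stays injective after tensoring. -/
lemma LinearMap.rTensor_ker_subtype_injective_of_flat_range (g : Y →ₗ[A] Z)
    [Module.Flat A (LinearMap.range g)] (M : Type*) [AddCommGroup M] [Module A M] :
    Function.Injective ((LinearMap.ker g).subtype.rTensor M) := by
  rw [← LinearMap.lTensor_inj_iff_rTensor_inj]
  refine LinearMap.lTensor_injective_of_exact_of_flat g.rangeRestrict g.surjective_rangeRestrict _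
    (Submodule.subtype_injective _) ?_ M
  rw [LinearMap.exact_iff, LinearMap.ker_rangeRestrict, Submodule.range_subtype]

/-- The kernel of a linear map with flat source and flat range is flat. -/
lemma Module.Flat.ker_of_flat_range (g : Y →ₗ[A] Z) [Module.Flat A Y]
    [Module.Flat A (LinearMap.range g)] : Module.Flat A (LinearMap.ker g) := by
  rw [Module.Flat.iff_rTensor_injective']
  intro I
  have h : Function.Injective
      ((I.subtype.rTensor Y).comp ((LinearMap.ker g).subtype.lTensor I)) := by
    refine (Module.Flat.rTensor_preserves_injective_linearMap _ I.subtype_injective).comp ?_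
    rw [LinearMap.lTensor_inj_iff_rTensor_inj]
    exact g.rTensor_ker_subtype_injective_of_flat_range I
  rw [LinearMap.rTensor_comp_lTensor, ← LinearMap.lTensor_comp_rTensor] at h
  exact Function.Injective.of_comp h

/-- If the inclusion of `range g` stays injective after tensoring with `M`, then
`ker (g ⊗ M)` is the image of `ker g ⊗ M`. -/
lemma LinearMap.exact_rTensor_ker_subtype (g : Y →ₗ[A] Z) (M : Type*) [AddCommGroup M]
    [Module A M] (h : Function.Injective ((LinearMap.range g).subtype.rTensor M)) :
    Function.Exact ((LinearMap.ker g).subtype.rTensor M) (g.rTensor M) := by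
  have hex : Function.Exact (LinearMap.ker g).subtype g.rangeRestrict := by
    rw [LinearMap.exact_iff, LinearMap.ker_rangeRestrict, Submodule.range_subtype]
  have hg : g.rTensor M = ((LinearMap.range g).subtype.rTensor M).comp
      (g.rangeRestrict.rTensor M) := by
    rw [← LinearMap.rTensor_comp]
    rfl
  rw [hg]
  exact (rTensor_exact M hex g.surjective_rangeRestrict).comp_injective _ h (map_zero _)

/-- If forming `ker g` commutes with tensoring with `M`, then so does forming the homology of
`X → Y → Z` at `Y`. -/
lemma LinearMap.exists_homology_rTensor_equiv (f : X →ₗ[A] Y) (g : Y →ₗ[A] Z) (hfg : g.comp f = 0)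
    (M : Type*) [AddCommGroup M] [Module A M]
    (hinj : Function.Injective ((LinearMap.ker g).subtype.rTensor M))
    (hex : Function.Exact ((LinearMap.ker g).subtype.rTensor M) (g.rTensor M)) :
    ∃ e : ((↥(LinearMap.ker g) ⧸ (LinearMap.range f).comap (LinearMap.ker g).subtype) ⊗[A] M) ≃ₗ[A]
          (↥(LinearMap.ker (g.rTensor M)) ⧸
            (LinearMap.range (f.rTensor M)).comap (LinearMap.ker (g.rTensor M)).subtype),
      ∀ (c : LinearMap.ker g) (m : M) (h : (c : Y) ⊗ₜ[A] m ∈ LinearMap.ker (g.rTensor M)),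
        e (Submodule.Quotient.mk c ⊗ₜ[A] m) = Submodule.Quotient.mk ⟨(c : Y) ⊗ₜ[A] m, h⟩ := by
  let d : X →ₗ[A] LinearMap.ker g := f.codRestrict _ fun x ↦ LinearMap.congr_fun hfg x
  have hd : (LinearMap.ker g).subtype.comp d = f := f.subtype_comp_codRestrict _ _
  have hdq : Function.Exact d
      ((LinearMap.range f).comap (LinearMap.ker g).subtype).mkQ := by
    rw [LinearMap.exact_iff, Submodule.ker_mkQ]
    exact (LinearMap.range_codRestrict _ _ _).symm
  let E : (LinearMap.ker g ⊗[A] M) ≃ₗ[A] LinearMap.ker (g.rTensor M) :=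
    (LinearEquiv.ofInjective _ hinj).trans (LinearEquiv.ofEq _ _ (LinearMap.exact_iff.mp hex).symm)
  have hE (x) : (E x : Y ⊗[A] M) = (LinearMap.ker g).subtype.rTensor M x := rfl
  have hmap : (LinearMap.range (d.rTensor M)).map (E : _ →ₗ[A] _) =
      (LinearMap.range (f.rTensor M)).comap (LinearMap.ker (g.rTensor M)).subtype := by
    have hEd (x) : (E (d.rTensor M x) : Y ⊗[A] M) = f.rTensor M x := by
      rw [hE, ← LinearMap.comp_apply, ← LinearMap.rTensor_comp, hd]
    ext y
    simp [LinearEquiv.eq_symm_apply, Subtype.ext_iff, hEd]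
  refine ⟨(rTensor.equiv M hdq (Submodule.mkQ_surjective _)).symm.trans
    (Submodule.Quotient.equiv _ _ E hmap), fun c m h ↦ ?_⟩
  have hq : Submodule.Quotient.mk c ⊗ₜ[A] m = rTensor.equiv M hdq (Submodule.mkQ_surjective _)
      (Submodule.Quotient.mk (c ⊗ₜ[A] m)) := rfl
  rw [hq, LinearEquiv.trans_apply, LinearEquiv.symm_apply_apply]
  rfl

end KernelsAndFlatness

/-- In a bounded complex of flat modules that is exact in degrees `≥ 2`, the cocycles in
degrees `≥ 2` are flat. -/
lemma flat_ker_of_bounded_of_exact {A : Type*} [CommRing A]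
    (N : ℕ) (C : ℕ → Type*) [∀ l, AddCommGroup (C l)] [∀ l, Module A (C l)]
    [∀ l, Module.Flat A (C l)] (δ : ∀ l, C l →ₗ[A] C (l + 1))
    (hconc : ∀ l, N < l → ∀ x : C l, x = 0)
    (hex : ∀ l, LinearMap.range (δ (l + 1)) = LinearMap.ker (δ (l + 2))) (l : ℕ) :
    Module.Flat A (LinearMap.ker (δ (l + 2))) := by
  suffices h : ∀ k l, N < l + 2 + k → Module.Flat A (LinearMap.ker (δ (l + 2))) from
    h (N + 1) l (by lia)
  intro k
  induction k with
  | zero =>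
    intro l hl
    have : Subsingleton (C (l + 2)) := subsingleton_of_forall_eq 0 (hconc _ hl)
    infer_instance
  | succ k ih =>
    intro l hl
    have : Module.Flat A (LinearMap.range (δ (l + 2))) := by
      rw [hex (l + 1)]
      exact ih (l + 1) (by lia)
    exact Module.Flat.ker_of_flat_range _

/-- **Base change for `H¹` of a bounded complex of flat modules.**
Let `C : 0 → C⁰ → C¹ → ⋯ → C^N → 0` be a cochain complex of flat `A`-modules
with `H^l(C) = 0` for all `l ≥ 2`.  Then for every `A`-module `M` the canonical
map `H¹(C) ⊗[A] M → H¹(C ⊗[A] M)`, `[c] ⊗ m ↦ [c ⊗ m]`, is an isomorphism. -/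
theorem h1_tensor_base_change
    {A : Type*} [CommRing A] {M : Type*} [AddCommGroup M] [Module A M]
    (N : ℕ) (C : ℕ → Type*) [∀ l, AddCommGroup (C l)] [∀ l, Module A (C l)]
    [∀ l, Module.Flat A (C l)]
    (δ : ∀ l, C l →ₗ[A] C (l + 1))
    (hcmpl : ∀ l, (δ (l + 1)).comp (δ l) = 0)
    (hconc : ∀ l, N < l → ∀ x : C l, x = 0)
    (hvan : ∀ l, LinearMap.ker (δ (l + 2)) ≤ LinearMap.range (δ (l + 1))) :
    ∃ e : ((↥(LinearMap.ker (δ 1)) ⧸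
              (LinearMap.range (δ 0)).comap (LinearMap.ker (δ 1)).subtype)
            ⊗[A] M)
          ≃ₗ[A]
          (↥(LinearMap.ker (LinearMap.rTensor M (δ 1))) ⧸
              (LinearMap.range (LinearMap.rTensor M (δ 0))).comap
                (LinearMap.ker (LinearMap.rTensor M (δ 1))).subtype),
      ∀ (c : LinearMap.ker (δ 1)) (m : M)
        (h : (c : C 1) ⊗ₜ[A] m ∈ LinearMap.ker (LinearMap.rTensor M (δ 1))),
        e (Submodule.Quotient.mk c ⊗ₜ[A] m)
          = Submodule.Quotient.mk
              (⟨(c : C 1) ⊗ₜ[A] m, h⟩ :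
                LinearMap.ker (LinearMap.rTensor M (δ 1))) := by
  have hex (l : ℕ) : LinearMap.range (δ (l + 1)) = LinearMap.ker (δ (l + 2)) :=
    le_antisymm (LinearMap.range_le_ker_iff.mpr (hcmpl (l + 1))) (hvan l)
  have hflat (l : ℕ) : Module.Flat A (LinearMap.range (δ (l + 1))) := by
    rw [hex l]
    exact flat_ker_of_bounded_of_exact N C δ hconc hex l
  have := hflat 0
  have := hflat 1
  refine LinearMap.exists_homology_rTensor_equiv (δ 0) (δ 1) (hcmpl 0) M
    ((δ 1).rTensor_ker_subtype_injective_of_flat_range M)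
    ((δ 1).exact_rTensor_ker_subtype M ?_)
  rw [hex 0]
  exact (δ 2).rTensor_ker_subtype_injective_of_flat_range M
end

section
/- Let k be a commutative ring and let N be a finitely generated module over the polynomial ring k[z]. Suppose N admits a direct sum decomposition N = ⊕_{i ∈ ℤ} N_i into k-submodules such that z · N_i ⊆ N_{i+1} for all i ∈ ℤ. If zN = N (equivalently, N/zN = 0), then N = 0; in particular, N/(z−1)N = 0. -/
open Polynomial in
theorem Polynomial.X_pow_smul_mem_of_graded {k N : Type*} [CommRing k] [AddCommGroup N]
    [Module k[X] N] [Module k N] {𝒩 : ℤ → Submodule k N}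
    (hgr : ∀ (i : ℤ) (x : N), x ∈ 𝒩 i → (X : k[X]) • x ∈ 𝒩 (i + 1))
    {i : ℤ} {x : N} (hx : x ∈ 𝒩 i) (n : ℕ) : (X ^ n : k[X]) • x ∈ 𝒩 (i + n) := by
  induction n with
  | zero => simpa using hx
  | succ n ih =>
    rw [pow_succ', mul_smul, Nat.cast_succ, ← add_assoc]
    exact hgr _ _ ih

open Polynomial in
theorem Polynomial.X_mul_smul_mem_iSup_of_graded {k N : Type*} [CommRing k] [AddCommGroup N]
    [Module k[X] N] [Module k N] [IsScalarTower k k[X] N] {𝒩 : ℤ → Submodule k N}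
    (hgr : ∀ (i : ℤ) (x : N), x ∈ 𝒩 i → (X : k[X]) • x ∈ 𝒩 (i + 1))
    {i : ℤ} {x : N} (hx : x ∈ 𝒩 i) (q : k[X]) : (X * q) • x ∈ ⨆ j, ⨆ _ : j ≠ i, 𝒩 j := by
  induction q using Polynomial.induction_on' with
  | add p q hp hq =>
    rw [mul_add, add_smul]
    exact add_mem hp hq
  | monomial n c =>
    have h : (X * monomial n c : k[X]) = c • X ^ (n + 1) := by
      rw [X_mul_monomial, smul_X_eq_monomial]
    rw [h, smul_assoc]
    have hne : i + ((n + 1 : ℕ) : ℤ) ≠ i := by lia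
    exact Submodule.smul_mem _ c <|
      le_iSup₂_of_le (f := fun j (_ : j ≠ i) => 𝒩 j) _ hne le_rfl
        (X_pow_smul_mem_of_graded hgr hx (n + 1))

/-- **Graded Nakayama over `k[z]`.**
Let `k` be a commutative ring and `N` a finitely generated `k[z]`-module
admitting a direct sum decomposition `N = ⊕_{i ∈ ℤ} N_i` into `k`-submodules
with `z • N_i ⊆ N_{i+1}`.  If `zN = N` then `N = 0`. -/
theorem graded_nakayama_polynomial
    {k : Type*} [CommRing k] {N : Type*} [AddCommGroup N]
    [Module (Polynomial k) N] [Module k N]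
    [IsScalarTower k (Polynomial k) N]
    [Module.Finite (Polynomial k) N]
    (𝒩 : ℤ → Submodule k N)
    (hinternal : DirectSum.IsInternal 𝒩)
    (hgr : ∀ (i : ℤ) (x : N), x ∈ 𝒩 i →
      (Polynomial.X : Polynomial k) • x ∈ 𝒩 (i + 1))
    (hzN : Function.Surjective
      (fun x : N => (Polynomial.X : Polynomial k) • x)) :
    ∀ x : N, x = 0 := by
  obtain ⟨r, hr, hr0⟩ :=
    Submodule.exists_sub_one_mem_and_smul_eq_zero_of_fg_of_le_smul
      (Ideal.span {(Polynomial.X : Polynomial k)}) (⊤ : Submodule (Polynomial k) N)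
      Module.Finite.fg_top fun x _ => by
        obtain ⟨y, rfl⟩ := hzN x
        exact Submodule.smul_mem_smul (Ideal.mem_span_singleton_self _) trivial
  obtain ⟨q, hq⟩ := Ideal.mem_span_singleton'.mp hr
  have hbot (i : ℤ) : 𝒩 i = ⊥ := by
    refine (Submodule.eq_bot_iff _).mpr fun x hx => ?_
    refine Submodule.disjoint_def.mp (hinternal.submodule_iSupIndep i) x hx ?_
    have hxq : x = -((Polynomial.X * q) • x) := by
      rw [mul_comm, hq, sub_smul, hr0 x trivial, one_smul, zero_sub, neg_neg]
    rw [hxq]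
    exact neg_mem (Polynomial.X_mul_smul_mem_iSup_of_graded hgr hx q)
  have htop := hinternal.submodule_iSup_eq_top
  rw [iSup_congr hbot, iSup_bot] at htop
  exact fun x => (Submodule.mem_bot k).mp (htop ▸ Submodule.mem_top)
end
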